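/- arXiv:2208.08661 — 5 statements merged into one kernel-verified Lean document; each statement's English description precedes it below -/
import Mathlib

section
/- Let X be a measurable space, let μ_1, …, μ_K and μ_T be probability measures on X with μ_T absolutely continuous with respect to μ_i for every i, and let f̂, f_T, f_1, …, f_K : X → ℝ be measurable functions such that all the integrals below are finite. Let α_1, …, α_K ≥ 0 satisfy Σ_{i=1}^K α_i = 1. Then ∫ |f̂ − f_T| dμ_T ≤ Σ_{i=1}^K ( ∫ α_i · (dμ_T/dμ_i) · |f̂ − f_i| dμ_i + α_i · ∫ |f_i − f_T| dμ_T ), where dμ_T/dμ_i denotes the Radon–Nikodym derivative of μ_T with respect to μ_i. -/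
open MeasureTheory

/-- Change of measure: weighting by the density `dμ/dν` turns a `ν`-integral into a `μ`-integral. -/
lemma integral_const_mul_rnDeriv_mul {X : Type*} [MeasurableSpace X] {μ ν : Measure X}
    [SigmaFinite μ] [SigmaFinite ν] (hμν : μ ≪ ν) (a : ℝ) (g : X → ℝ) :
    ∫ x, a * (μ.rnDeriv ν x).toReal * g x ∂ν = a * ∫ x, g x ∂μ := by
  simp_rw [mul_assoc, integral_const_mul, ← smul_eq_mul (μ.rnDeriv ν _).toReal,
    integral_rnDeriv_smul hμν]

/-- The `L¹` distance satisfies the triangle inequality. -/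
lemma integral_abs_sub_le_add {X : Type*} [MeasurableSpace X] {μ : Measure X} {f g h : X → ℝ}
    (hf : Measurable f) (hg : Measurable g)
    (hfh : Integrable (fun x => |f x - h x|) μ) (hgh : Integrable (fun x => |g x - h x|) μ) :
    ∫ x, |f x - h x| ∂μ ≤ ∫ x, |f x - g x| ∂μ + ∫ x, |g x - h x| ∂μ := by
  have hfg : Integrable (fun x => |f x - g x|) μ := by
    refine (hfh.add hgh).mono' (hf.sub hg).abs.aestronglyMeasurable (.of_forall fun x => ?_)
    simpa [abs_sub_comm (g x)] using abs_sub_le (f x) (h x) (g x)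
  rw [← integral_add hfg hgh]
  exact integral_mono hfh (hfg.add hgh) fun x => abs_sub_le _ _ _

/-- The paper's main generalization bound (Equation 5): the target error of a
hypothesis `fhat` is bounded by the sum over source domains of the
density-ratio-reweighted source errors plus the adaptivity gaps. -/
theorem drm_main_bound {X : Type*} [MeasurableSpace X] (K : ℕ)
    (μ : Fin K → Measure X) (μT : Measure X)
    [∀ i, IsProbabilityMeasure (μ i)] [IsProbabilityMeasure μT]
    (hac : ∀ i, μT ≪ μ i)
    (fhat fT : X → ℝ) (f : Fin K → X → ℝ)
    (hfhat : Measurable fhat) (hfT : Measurable fT) (hf : ∀ i, Measurable (f i))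
    (α : Fin K → ℝ) (hα : ∀ i, 0 ≤ α i) (hαsum : ∑ i, α i = 1)
    (hintT : Integrable (fun x => |fhat x - fT x|) μT)
    (hintS : ∀ i, Integrable
      (fun x => α i * (μT.rnDeriv (μ i) x).toReal * |fhat x - f i x|) (μ i))
    (hintG : ∀ i, Integrable (fun x => |f i x - fT x|) μT) :
    ∫ x, |fhat x - fT x| ∂μT ≤
      ∑ i, ((∫ x, α i * (μT.rnDeriv (μ i) x).toReal * |fhat x - f i x| ∂(μ i))
        + α i * ∫ x, |f i x - fT x| ∂μT) := by
  calc ∫ x, |fhat x - fT x| ∂μT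
      = ∑ i, α i * ∫ x, |fhat x - fT x| ∂μT := by rw [← Finset.sum_mul, hαsum, one_mul]
    _ ≤ _ := Finset.sum_le_sum fun i _ => by
      rw [integral_const_mul_rnDeriv_mul (hac i), ← mul_add]
      exact mul_le_mul_of_nonneg_left
        (integral_abs_sub_le_add hfhat (hf i) hintT (hintG i)) (hα i)
end

section
/- Let X be a measurable space, H a nonempty set of measurable functions X → {0,1}, and P, Q probability measures on X. Let f, f' : X → {0,1} be measurable functions such that the disagreement indicator x ↦ |f(x) − f'(x)| belongs to H. Then |ε_P(f, f') − ε_Q(f, f')| ≤ d_H(P, Q), where ε_μ(f, f') := ∫ |f − f'| dμ. -/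
open MeasureTheory

/-- The H-divergence `d_H(P, Q) := 2 · sup_{h ∈ H} |∫ h dP − ∫ h dQ|` of two
measures with respect to a hypothesis class `H` of `{0,1}`-valued functions. -/
noncomputable def hDivergence {X : Type*} [MeasurableSpace X]
    (H : Set (X → ℝ)) (P Q : Measure X) : ℝ :=
  2 * ⨆ h : H, |(∫ x, (h : X → ℝ) x ∂P) - ∫ x, (h : X → ℝ) x ∂Q|

/-- The integral of a function with values in `[0, 1]` against a probability measure lies in
`[0, 1]`. -/
theorem integral_mem_Icc_zero_one {X : Type*} [MeasurableSpace X] (μ : Measure X)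
    [IsProbabilityMeasure μ] {h : X → ℝ} (hh : ∀ x, h x ∈ Set.Icc (0 : ℝ) 1) :
    ∫ x, h x ∂μ ∈ Set.Icc (0 : ℝ) 1 := by
  refine ⟨integral_nonneg fun x => (hh x).1, ?_⟩
  calc ∫ x, h x ∂μ ≤ ∫ _, (1 : ℝ) ∂μ :=
        integral_mono_of_nonneg (.of_forall fun x => (hh x).1) (integrable_const 1)
          (.of_forall fun x => (hh x).2)
    _ = 1 := by simp

/-- The integral discrepancies defining `hDivergence` are bounded above when the hypotheses take
values in `[0, 1]`. -/
theorem bddAbove_range_abs_integral_sub {X : Type*} [MeasurableSpace X]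
    {H : Set (X → ℝ)} (hH : ∀ h ∈ H, ∀ x, h x ∈ Set.Icc (0 : ℝ) 1)
    (P Q : Measure X) [IsProbabilityMeasure P] [IsProbabilityMeasure Q] :
    BddAbove (Set.range fun h : H =>
      |(∫ x, (h : X → ℝ) x ∂P) - ∫ x, (h : X → ℝ) x ∂Q|) := by
  refine ⟨1, ?_⟩
  rintro _ ⟨⟨h, hh⟩, rfl⟩
  obtain ⟨hP₀, hP₁⟩ := integral_mem_Icc_zero_one P (hH h hh)
  obtain ⟨hQ₀, hQ₁⟩ := integral_mem_Icc_zero_one Q (hH h hh)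
  exact abs_sub_le_iff.2 ⟨by linarith, by linarith⟩

/-- Equation 14 (Lemma 4.1 of Albuquerque et al.): the error discrepancy of a
pair of binary functions between two distributions is controlled by the
H-divergence, provided their disagreement indicator lies in `H`. -/
theorem error_discrepancy_le_hDivergence {X : Type*} [MeasurableSpace X]
    (H : Set (X → ℝ)) (hHne : H.Nonempty)
    (hH : ∀ h ∈ H, Measurable h ∧ ∀ x, h x = 0 ∨ h x = 1)
    (P Q : Measure X) [IsProbabilityMeasure P] [IsProbabilityMeasure Q]
    (f f' : X → ℝ) (hf : Measurable f) (hf' : Measurable f')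
    (hfbin : ∀ x, f x = 0 ∨ f x = 1) (hf'bin : ∀ x, f' x = 0 ∨ f' x = 1)
    (hdis : (fun x => |f x - f' x|) ∈ H) :
    |(∫ x, |f x - f' x| ∂P) - ∫ x, |f x - f' x| ∂Q| ≤ hDivergence H P Q := by
  have hbdd := bddAbove_range_abs_integral_sub
    (fun h hh x => by rcases (hH h hh).2 x with hx | hx <;> simp [hx]) P Q
  have hle := le_ciSup hbdd ⟨_, hdis⟩
  have hnonneg := (abs_nonneg _).trans hle
  unfold hDivergence
  linarith
end

section
/- Let X be a measurable space, H a nonempty set of measurable functions X → {0,1}, and P_S, P_T probability measures on X (source and target). Let f̂, f_S, f_T : X → {0,1} be measurable functions such that both disagreement indicators x ↦ |f̂(x) − f_S(x)| and x ↦ |f_S(x) − f_T(x)| belong to H. Then ε_{P_T}(f̂, f_T) ≤ ε_{P_S}(f̂, f_S) + d_H(P_S, P_T) + min{ ε_{P_S}(f_S, f_T) + d_H(P_S, P_T), ε_{P_T}(f_S, f_T) }. -/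
open MeasureTheory

/-- The integral of a measurable `{0,1}`-valued function against a probability measure
lies in `[0, 1]`. -/
theorem integral_mem_Icc_of_binary {X : Type*} [MeasurableSpace X] (P : Measure X)
    [IsProbabilityMeasure P] {h : X → ℝ} (hm : Measurable h)
    (hb : ∀ x, h x = 0 ∨ h x = 1) :
    ∫ x, h x ∂P ∈ Set.Icc (0 : ℝ) 1 := by
  have h01 : ∀ x, h x ∈ Set.Icc (0 : ℝ) 1 := fun x => by
    rcases hb x with hx | hx <;> simp [hx]
  have hint : Integrable h P := Integrable.of_mem_Icc 0 1 hm.aemeasurable (.of_forall h01)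
  refine ⟨integral_nonneg fun x => (h01 x).1, ?_⟩
  simpa using integral_mono hint (integrable_const (1 : ℝ)) fun x => (h01 x).2

/-- Members of a binary hypothesis class have expectations differing by at most the
H-divergence. -/
theorem integral_le_integral_add_hDivergence {X : Type*} [MeasurableSpace X]
    {H : Set (X → ℝ)} (hH : ∀ h ∈ H, Measurable h ∧ ∀ x, h x = 0 ∨ h x = 1)
    (P Q : Measure X) [IsProbabilityMeasure P] [IsProbabilityMeasure Q]
    {h : X → ℝ} (hh : h ∈ H) :
    ∫ x, h x ∂Q ≤ (∫ x, h x ∂P) + hDivergence H P Q := by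
  have hbdd : BddAbove (Set.range fun h : H =>
      |(∫ x, (h : X → ℝ) x ∂P) - ∫ x, (h : X → ℝ) x ∂Q|) := by
    refine ⟨1, ?_⟩
    rintro _ ⟨⟨g, hg⟩, rfl⟩
    obtain ⟨hP0, hP1⟩ := integral_mem_Icc_of_binary P (hH g hg).1 (hH g hg).2
    obtain ⟨hQ0, hQ1⟩ := integral_mem_Icc_of_binary Q (hH g hg).1 (hH g hg).2
    exact abs_le.2 ⟨by linarith, by linarith⟩
  have hle := le_ciSup hbdd ⟨h, hh⟩
  have habs := neg_abs_le ((∫ x, h x ∂P) - ∫ x, h x ∂Q)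
  have hnonneg := abs_nonneg ((∫ x, h x ∂P) - ∫ x, h x ∂Q)
  unfold hDivergence
  dsimp only at hle
  linarith

/-- Equation 15 (Theorem 4.1 of Albuquerque et al.): the target error is
bounded by the source error, the H-divergence, and a label-disagreement term. -/
theorem target_error_bound {X : Type*} [MeasurableSpace X]
    (H : Set (X → ℝ)) (hHne : H.Nonempty)
    (hH : ∀ h ∈ H, Measurable h ∧ ∀ x, h x = 0 ∨ h x = 1)
    (PS PT : Measure X) [IsProbabilityMeasure PS] [IsProbabilityMeasure PT]
    (fhat fS fT : X → ℝ)
    (hfhat : Measurable fhat) (hfS : Measurable fS) (hfT : Measurable fT)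
    (hfhatbin : ∀ x, fhat x = 0 ∨ fhat x = 1)
    (hfSbin : ∀ x, fS x = 0 ∨ fS x = 1) (hfTbin : ∀ x, fT x = 0 ∨ fT x = 1)
    (hdis1 : (fun x => |fhat x - fS x|) ∈ H)
    (hdis2 : (fun x => |fS x - fT x|) ∈ H) :
    ∫ x, |fhat x - fT x| ∂PT ≤
      (∫ x, |fhat x - fS x| ∂PS) + hDivergence H PS PT +
        min ((∫ x, |fS x - fT x| ∂PS) + hDivergence H PS PT)
          (∫ x, |fS x - fT x| ∂PT) := by
  have hint : ∀ {f g : X → ℝ}, Measurable f → Measurable g → (∀ x, f x = 0 ∨ f x = 1) →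
      (∀ x, g x = 0 ∨ g x = 1) → Integrable (fun x => |f x - g x|) PT := by
    intro f g hf hg hfb hgb
    refine Integrable.of_mem_Icc 0 1 (by fun_prop) (.of_forall fun x => ?_)
    rcases hfb x with hx | hx <;> rcases hgb x with hy | hy <;> simp [hx, hy]
  have hint1 := hint hfhat hfS hfhatbin hfSbin
  have hint2 := hint hfS hfT hfSbin hfTbin
  have htri : ∫ x, |fhat x - fT x| ∂PT ≤
      (∫ x, |fhat x - fS x| ∂PT) + ∫ x, |fS x - fT x| ∂PT := by
    rw [← integral_add hint1 hint2]
    exact integral_mono (hint hfhat hfT hfhatbin hfTbin) (hint1.add hint2)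
      fun x => abs_sub_le _ _ _
  have hdiv1 := integral_le_integral_add_hDivergence hH PS PT hdis1
  have hdiv2 := integral_le_integral_add_hDivergence hH PS PT hdis2
  exact htri.trans (add_le_add hdiv1 (le_min hdiv2 le_rfl))
end

section
/- Let X be a measurable space and H a nonempty set of measurable functions X → {0,1}. Let μ_1, …, μ_K be source probability measures on X with labeling functions f_1, …, f_K : X → {0,1}, let μ_T be a target probability measure on X with labeling function f_T : X → {0,1}, and let α_1, …, α_K ≥ 0 with Σ_i α_i = 1; write μ_α := Σ_i α_i μ_i. Let f̂, f* : X → {0,1} be measurable functions whose disagreement indicator x ↦ |f̂(x) − f*(x)| belongs to H. Then for every probability measure ν on X, ε_{μ_T}(f̂, f_T) ≤ ε_{μ_T}(f*, f_T) + Σ_{i=1}^K ε_{μ_i}(f*, f_i) + Σ_{i=1}^K α_i ε_{μ_i}(f̂, f_i) + d_H(ν, μ_α) + d_H(μ_T, ν). -/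
open MeasureTheory

theorem integrable_of_forall_eq_zero_or_one {X : Type*} [MeasurableSpace X] (P : Measure X)
    [IsFiniteMeasure P] {g : X → ℝ} (hg : Measurable g) (hbin : ∀ x, g x = 0 ∨ g x = 1) :
    Integrable g P := by
  refine Integrable.of_bound hg.aestronglyMeasurable 1 (Filter.Eventually.of_forall fun x => ?_)
  rcases hbin x with h | h <;> simp [h]

theorem abs_integral_sub_le_hDivergence {X : Type*} [MeasurableSpace X] {H : Set (X → ℝ)}
    (hH : ∀ h ∈ H, ∀ x, h x = 0 ∨ h x = 1) (P Q : Measure X)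
    [IsFiniteMeasure P] [IsFiniteMeasure Q] {g : X → ℝ} (hg : g ∈ H) :
    |(∫ x, g x ∂P) - ∫ x, g x ∂Q| ≤ hDivergence H P Q := by
  have bound (ρ : Measure X) [IsFiniteMeasure ρ] (h : X → ℝ) (hh : h ∈ H) :
      |(∫ x, h x ∂ρ)| ≤ ρ.real Set.univ := by
    have := norm_integral_le_of_norm_le_const (μ := ρ) (f := h) (C := 1)
      (Filter.Eventually.of_forall fun x => by rcases hH h hh x with h | h <;> simp [h])
    simpa using this
  have hbdd : BddAbove (Set.range fun h : H =>
      |(∫ x, (h : X → ℝ) x ∂P) - ∫ x, (h : X → ℝ) x ∂Q|) := by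
    refine ⟨P.real Set.univ + Q.real Set.univ, ?_⟩
    rintro _ ⟨h, rfl⟩
    exact (abs_sub _ _).trans (add_le_add (bound P h h.2) (bound Q h h.2))
  have hle := le_ciSup hbdd ⟨g, hg⟩
  have hnonneg := abs_nonneg ((∫ x, g x ∂P) - ∫ x, g x ∂Q)
  unfold hDivergence
  dsimp only at hle
  linarith

theorem integral_abs_sub_triangle {X : Type*} [MeasurableSpace X] {P : Measure X}
    {a b c : X → ℝ} (ha : Integrable a P) (hb : Integrable b P) (hc : Integrable c P) :
    ∫ x, |a x - c x| ∂P ≤ (∫ x, |a x - b x| ∂P) + ∫ x, |b x - c x| ∂P := by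
  rw [← integral_add (f := fun x => |a x - b x|) (g := fun x => |b x - c x|)
    (ha.sub hb).abs (hb.sub hc).abs]
  exact integral_mono (ha.sub hc).abs ((ha.sub hb).abs.add (hb.sub hc).abs)
    fun x => abs_sub_le _ _ _

theorem integral_sum_ofReal_smul {X ι : Type*} [MeasurableSpace X] [Fintype ι]
    (μ : ι → Measure X) {α : ι → ℝ} (hα : ∀ i, 0 ≤ α i) {g : X → ℝ}
    (hg : ∀ i, Integrable g (μ i)) :
    ∫ x, g x ∂(∑ i, ENNReal.ofReal (α i) • μ i) = ∑ i, α i * ∫ x, g x ∂(μ i) := by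
  rw [integral_finsetSum_measure fun i _ => (hg i).smul_measure ENNReal.ofReal_ne_top]
  simp [integral_smul_measure, ENNReal.toReal_ofReal, hα]

/-- The learning bound of Equation 8 derived in Appendix A.1 (the precise form
of Proposition 1): the target error is bounded by the joint risk of the
reference hypothesis `fstar`, the α-weighted source errors, and two
H-divergence terms through an intermediate distribution `ν`. -/
theorem learning_bound_appendix {X : Type*} [MeasurableSpace X] (K : ℕ)
    (H : Set (X → ℝ)) (hHne : H.Nonempty)
    (hH : ∀ h ∈ H, Measurable h ∧ ∀ x, h x = 0 ∨ h x = 1)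
    (μ : Fin K → Measure X) (μT : Measure X)
    [∀ i, IsProbabilityMeasure (μ i)] [IsProbabilityMeasure μT]
    (f : Fin K → X → ℝ) (fT fhat fstar : X → ℝ)
    (hf : ∀ i, Measurable (f i)) (hfT : Measurable fT)
    (hfhat : Measurable fhat) (hfstar : Measurable fstar)
    (hfbin : ∀ i x, f i x = 0 ∨ f i x = 1) (hfTbin : ∀ x, fT x = 0 ∨ fT x = 1)
    (hfhatbin : ∀ x, fhat x = 0 ∨ fhat x = 1)
    (hfstarbin : ∀ x, fstar x = 0 ∨ fstar x = 1)
    (α : Fin K → ℝ) (hα : ∀ i, 0 ≤ α i) (hαsum : ∑ i, α i = 1)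
    (hdis : (fun x => |fhat x - fstar x|) ∈ H)
    (ν : Measure X) [IsProbabilityMeasure ν] :
    ∫ x, |fhat x - fT x| ∂μT ≤
      (∫ x, |fstar x - fT x| ∂μT) + (∑ i, ∫ x, |fstar x - f i x| ∂(μ i)) +
        (∑ i, α i * ∫ x, |fhat x - f i x| ∂(μ i)) +
        hDivergence H ν (∑ i, ENNReal.ofReal (α i) • μ i) +
        hDivergence H μT ν := by
  have int {P : Measure X} [IsFiniteMeasure P] {g : X → ℝ} (hg : Measurable g)
      (hbin : ∀ x, g x = 0 ∨ g x = 1) : Integrable g P :=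
    integrable_of_forall_eq_zero_or_one P hg hbin
  have : IsFiniteMeasure (∑ i, ENNReal.ofReal (α i) • μ i) := by
    refine ⟨?_⟩
    simp [Measure.finsetSum_apply, ENNReal.sum_lt_top]
  have hbin := fun h hh => (hH h hh).2
  have htarget := integral_abs_sub_triangle (P := μT) (int hfhat hfhatbin)
    (int hfstar hfstarbin) (int hfT hfTbin)
  have hdivT := (le_abs_self _).trans (abs_integral_sub_le_hDivergence hbin μT ν hdis)
  have hdivν := (le_abs_self _).trans (abs_integral_sub_le_hDivergence hbin ν
    (∑ i, ENNReal.ofReal (α i) • μ i) hdis)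
  have hmix : ∫ x, |fhat x - fstar x| ∂(∑ i, ENNReal.ofReal (α i) • μ i) ≤
      (∑ i, ∫ x, |fstar x - f i x| ∂(μ i)) + ∑ i, α i * ∫ x, |fhat x - f i x| ∂(μ i) := by
    rw [integral_sum_ofReal_smul μ hα (g := fun x => |fhat x - fstar x|)
      fun i => ((int hfhat hfhatbin).sub (int hfstar hfstarbin)).abs, ← Finset.sum_add_distrib]
    refine Finset.sum_le_sum fun i _ => ?_
    have htri := integral_abs_sub_triangle (P := μ i) (int hfhat hfhatbin)
      (int (hf i) (hfbin i)) (int hfstar hfstarbin)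
    simp only [abs_sub_comm (f i _) (fstar _)] at htri
    have hα1 : α i ≤ 1 :=
      hαsum ▸ Finset.single_le_sum (fun j _ => hα j) (Finset.mem_univ i)
    have hmul := mul_le_mul_of_nonneg_left htri (hα i)
    have hle := mul_le_of_le_one_left
      (integral_nonneg (μ := μ i) fun x => abs_nonneg (fstar x - f i x)) hα1
    linarith
  linarith
end

section
/- Let X and Z be measurable spaces, let μ_r and μ_b be probability measures on X, and let g : X → Z be measurable such that the pushforwards coincide: g_*μ_r = g_*μ_b = ν. Suppose there is a measurable φ : Z → {0,1} such that the labeling functions f_r, f_b : X → {0,1} satisfy f_r(x) = φ(g(x)) for μ_r-almost every x and f_b(x) = 1 − φ(g(x)) for μ_b-almost every x. Then for every measurable h : Z → {0,1}, ε_{μ_r}(h ∘ g, f_r) + ε_{μ_b}(h ∘ g, f_b) = 1. -/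
open MeasureTheory

/-- Failure case of marginal invariant representations (Section 3): if a
feature transformation `g` makes the two source distributions coincide in
feature space while their labeling functions are exactly reversed on the
shared induced distribution, then every prediction head `h` incurs total
source error exactly 1. -/
theorem invariant_representation_failure {X Z : Type*}
    [MeasurableSpace X] [MeasurableSpace Z]
    (μr μb : Measure X) [IsProbabilityMeasure μr] [IsProbabilityMeasure μb]
    (g : X → Z) (hg : Measurable g)
    (ν : Measure Z) (hνr : μr.map g = ν) (hνb : μb.map g = ν)
    (φ : Z → ℝ) (hφ : Measurable φ) (hφbin : ∀ z, φ z = 0 ∨ φ z = 1)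
    (fr fb : X → ℝ) (hfr : Measurable fr) (hfb : Measurable fb)
    (hfrbin : ∀ x, fr x = 0 ∨ fr x = 1) (hfbbin : ∀ x, fb x = 0 ∨ fb x = 1)
    (hfr_eq : ∀ᵐ x ∂μr, fr x = φ (g x))
    (hfb_eq : ∀ᵐ x ∂μb, fb x = 1 - φ (g x)) :
    ∀ h : Z → ℝ, Measurable h → (∀ z, h z = 0 ∨ h z = 1) →
      (∫ x, |h (g x) - fr x| ∂μr) + (∫ x, |h (g x) - fb x| ∂μb) = 1 := by
  intro h hh hbin
  have hr : ∫ x, |h (g x) - fr x| ∂μr = ∫ z, |h z - φ z| ∂ν := by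
    rw [← hνr, integral_map hg.aemeasurable (by fun_prop)]
    refine integral_congr_ae ?_
    filter_upwards [hfr_eq] with x hx
    rw [hx]
  have hb : ∫ x, |h (g x) - fb x| ∂μb = ∫ z, (1 - |h z - φ z|) ∂ν := by
    rw [← hνb, integral_map hg.aemeasurable (by fun_prop)]
    refine integral_congr_ae ?_
    filter_upwards [hfb_eq] with x hx
    rw [hx]
    rcases hbin (g x) with h₁ | h₁ <;> rcases hφbin (g x) with h₂ | h₂ <;> norm_num [h₁, h₂]
  have : IsProbabilityMeasure ν := hνr ▸ Measure.isProbabilityMeasure_map hg.aemeasurable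
  have hint : Integrable (fun z ↦ |h z - φ z|) ν := by
    refine Integrable.of_bound (by fun_prop) 1 (ae_of_all _ fun z ↦ ?_)
    rcases hbin z with h₁ | h₁ <;> rcases hφbin z with h₂ | h₂ <;> norm_num [h₁, h₂]
  rw [hr, hb, integral_sub (integrable_const 1) hint]
  simp
end
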